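/- Let S be a finite set of points in the Euclidean plane with |S| ≥ 3, and let ρ > 0 satisfy cost₂(S) ≥ 2√3·ρ. Then for any three pairwise distinct points a, b, c ∈ S, there is no point x of ℝ² with d(x,a) < ρ, d(x,b) < ρ and d(x,c) < ρ; that is, no point of the plane is properly contained in the intersection of the three disks of radius ρ centered at a, b and c. -/

import Mathlib

open scoped Classical

/-- `cost₂(p, S)`: the minimum over pairs of distinct points `q, q' ∈ S \ {p}` of
`d(p,q) + d(p,q')`. -/
noncomputable def cost2At (p : EuclideanSpace ℝ (Fin 2))
    (S : Finset (EuclideanSpace ℝ (Fin 2))) : ℝ :=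
  sInf {x : ℝ | ∃ q ∈ S.erase p, ∃ q' ∈ S.erase p, q ≠ q' ∧ x = dist p q + dist p q'}

/-- `cost₂(S) = min_{p ∈ S} cost₂(p, S)`. -/
noncomputable def cost2 (S : Finset (EuclideanSpace ℝ (Fin 2))) : ℝ :=
  sInf {x : ℝ | ∃ p ∈ S, x = cost2At p S}

theorem cost2_le_aux (S : Finset (EuclideanSpace ℝ (Fin 2)))
    (p q r : EuclideanSpace ℝ (Fin 2)) (hp : p ∈ S) (hq : q ∈ S) (hr : r ∈ S)
    (hpq : p ≠ q) (hpr : p ≠ r) (hqr : q ≠ r) :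
    cost2 S ≤ dist p q + dist p r := by
  have h0 : ∀ p' : EuclideanSpace ℝ (Fin 2), 0 ≤ cost2At p' S := by
    intro p'
    apply Real.sInf_nonneg
    rintro x ⟨q, _, q', _, _, rfl⟩
    positivity
  have h1 : cost2 S ≤ cost2At p S := by
    apply csInf_le
    · refine ⟨0, ?_⟩
      rintro x ⟨p', _, rfl⟩
      exact h0 p'
    · exact ⟨p, hp, rfl⟩
  refine h1.trans ?_
  apply csInf_le
  · refine ⟨0, ?_⟩
    rintro x ⟨q, _, q', _, _, rfl⟩
    positivity
  · exact ⟨q, Finset.mem_erase.2 ⟨hpq.symm, hq⟩, r, Finset.mem_erase.2 ⟨hpr.symm, hr⟩, hqr, rfl⟩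

theorem sides_aux (p q c K : ℝ) (hK : 0 ≤ K) (hp : q ≤ p) (hc : c ≤ p) (h : K ≤ q + c) :
    3 * K ^ 2 ≤ 4 * (p ^ 2 + q ^ 2 + c ^ 2) := by
  have h1 : K ^ 2 ≤ (q + c) ^ 2 := by gcongr
  have h2 : K ^ 2 ≤ (2 * p) ^ 2 := by gcongr; linarith
  nlinarith [sq_nonneg (q - c)]

/-- if `cost₂(S) ≥ 2√3·ρ`, no point of the plane is properly contained
in the intersection of the three open disks of radius `ρ` centered at three pairwise
distinct points of `S`. -/
theorem no_point_in_three_disks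
    (S : Finset (EuclideanSpace ℝ (Fin 2))) (hS : 3 ≤ S.card)
    (ρ : ℝ) (hρ : 0 < ρ) (hcost : 2 * Real.sqrt 3 * ρ ≤ cost2 S)
    (a b c : EuclideanSpace ℝ (Fin 2)) (ha : a ∈ S) (hb : b ∈ S) (hc : c ∈ S)
    (hab : a ≠ b) (hac : a ≠ c) (hbc : b ≠ c) :
    ¬ ∃ x : EuclideanSpace ℝ (Fin 2), dist x a < ρ ∧ dist x b < ρ ∧ dist x c < ρ := by
  rintro ⟨x, h1, h2, h3⟩
  have e1 := hcost.trans (cost2_le_aux S a b c ha hb hc hab hac hbc)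
  have e2 := hcost.trans (cost2_le_aux S b a c hb ha hc hab.symm hbc hac)
  have e3 := hcost.trans (cost2_le_aux S c a b hc ha hb hac.symm hbc.symm hab)
  rw [dist_comm b a] at e2
  rw [dist_comm c a, dist_comm c b] at e3
  have hs : (2 * Real.sqrt 3 * ρ) ^ 2 = 12 * ρ ^ 2 := by
    have : Real.sqrt 3 ^ 2 = 3 := Real.sq_sqrt (by norm_num)
    rw [mul_pow, mul_pow, this]; ring
  have hK : 0 ≤ 2 * Real.sqrt 3 * ρ := by positivity
  have key : 3 * (2 * Real.sqrt 3 * ρ) ^ 2 ≤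
      4 * (dist a b ^ 2 + dist a c ^ 2 + dist b c ^ 2) := by
    rcases le_total (dist a b) (dist a c) with i | i
    · rcases le_total (dist a c) (dist b c) with j | j
      · linarith [sides_aux (dist b c) (dist a b) (dist a c) _ hK (i.trans j) j e1]
      · linarith [sides_aux (dist a c) (dist a b) (dist b c) _ hK i j e2]
    · rcases le_total (dist a b) (dist b c) with j | j
      · linarith [sides_aux (dist b c) (dist a b) (dist a c) _ hK j (i.trans j) e1]
      · linarith [sides_aux (dist a b) (dist a c) (dist b c) _ hK i j e3]
  rw [hs] at key
  have g1 : dist x a ^ 2 < ρ ^ 2 := by gcongr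
  have g2 : dist x b ^ 2 < ρ ^ 2 := by gcongr
  have g3 : dist x c ^ 2 < ρ ^ 2 := by gcongr
  simp only [EuclideanSpace.dist_sq_eq, Fin.sum_univ_two, Real.dist_eq, sq_abs] at key g1 g2 g3
  nlinarith [sq_nonneg (a 0 + b 0 + c 0 - 3 * x 0), sq_nonneg (a 1 + b 1 + c 1 - 3 * x 1)]
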